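/- arXiv:0906.2508 — 5 statements merged into one kernel-verified Lean document; each statement's English description precedes it below -/
import Mathlib

section
/- Let a, b ⊆ Fin n be subsets of the n spins such that either a and b are disjoint or one is contained in the other. Then the total spin operators commute: S²_a * S²_b = S²_b * S²_a. -/
open Matrix

/-- The Pauli matrices σ_x, σ_y, σ_z, indexed by `Fin 3`. -/
noncomputable def pauli : Fin 3 → Matrix (Fin 2) (Fin 2) ℂ :=
  ![!![0, 1; 1, 0], !![0, -Complex.I; Complex.I, 0], !![1, 0; 0, -1]]

/-- The operator acting as the 2×2 matrix `A` on the `i`-th tensor factor of the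
`n`-qubit space and as the identity on all the others. -/
noncomputable def siteOp (n : ℕ) (A : Matrix (Fin 2) (Fin 2) ℂ) (i : Fin n) :
    Matrix (Fin n → Fin 2) (Fin n → Fin 2) ℂ :=
  Matrix.of fun x y =>
    A (x i) (y i) * ∏ j ∈ Finset.univ.filter (· ≠ i), (if x j = y j then (1 : ℂ) else 0)

/-- The spin component operator `S_w^{(i)} = (1/2) σ_w` acting on the `i`-th spin. -/
noncomputable def spinOp (n : ℕ) (w : Fin 3) (i : Fin n) :
    Matrix (Fin n → Fin 2) (Fin n → Fin 2) ℂ :=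
  siteOp n ((1 / 2 : ℂ) • pauli w) i

/-- The total spin operator `S²_a = Σ_w (Σ_{i ∈ a} S_w^{(i)})²` of a set `a` of spins. -/
noncomputable def totalSpin (n : ℕ) (a : Finset (Fin n)) :
    Matrix (Fin n → Fin 2) (Fin n → Fin 2) ℂ :=
  ∑ w : Fin 3, (∑ i ∈ a, spinOp n w i) ^ 2

theorem siteOp_apply (n : ℕ) (A : Matrix (Fin 2) (Fin 2) ℂ) (i : Fin n) (x y : Fin n → Fin 2) :
    siteOp n A i x y = ∑ s, A (x i) s * if Function.update x i s = y then 1 else 0 := by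
  have hprod : (∏ j ∈ Finset.univ.filter (· ≠ i), (if x j = y j then (1 : ℂ) else 0)) =
      if Function.update x i (y i) = y then 1 else 0 := by
    rw [Finset.prod_ite_zero]
    simp [Function.update_eq_iff]
  rw [Finset.sum_eq_single (y i), siteOp, Matrix.of_apply, hprod]
  · intro s _ hs
    rw [if_neg, mul_zero]
    rintro rfl
    simp at hs
  · simp

theorem siteOp_mulVec (n : ℕ) (A : Matrix (Fin 2) (Fin 2) ℂ) (i : Fin n)
    (v : (Fin n → Fin 2) → ℂ) (x : Fin n → Fin 2) :
    (siteOp n A i *ᵥ v) x = ∑ s, A (x i) s * v (Function.update x i s) := by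
  simp only [Matrix.mulVec, dotProduct, siteOp_apply, Finset.sum_mul]
  rw [Finset.sum_comm]
  simp

theorem siteOp_mul_siteOp (n : ℕ) (A B : Matrix (Fin 2) (Fin 2) ℂ) (i : Fin n) :
    siteOp n A i * siteOp n B i = siteOp n (A * B) i := by
  refine Matrix.ext_of_mulVec_single fun y => ?_
  ext x
  rw [← Matrix.mulVec_mulVec]
  simp only [siteOp_mulVec, Function.update_self, Function.update_idem, Matrix.mul_apply,
    Finset.mul_sum, Finset.sum_mul, mul_assoc]
  exact Finset.sum_comm

theorem siteOp_commute (n : ℕ) (A B : Matrix (Fin 2) (Fin 2) ℂ) {i j : Fin n} (hij : i ≠ j) :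
    Commute (siteOp n A i) (siteOp n B j) := by
  refine Matrix.ext_of_mulVec_single fun y => ?_
  ext x
  rw [← Matrix.mulVec_mulVec, ← Matrix.mulVec_mulVec]
  simp only [siteOp_mulVec, Function.update_of_ne hij, Function.update_of_ne hij.symm,
    Finset.mul_sum]
  rw [Finset.sum_comm]
  refine Finset.sum_congr rfl fun s _ => Finset.sum_congr rfl fun t _ => ?_
  rw [Function.update_comm hij]
  ring

theorem siteOp_sub (n : ℕ) (A B : Matrix (Fin 2) (Fin 2) ℂ) (i : Fin n) :
    siteOp n (A - B) i = siteOp n A i - siteOp n B i := by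
  ext x y
  simp [siteOp, sub_mul]

theorem siteOp_smul (n : ℕ) (c : ℂ) (A : Matrix (Fin 2) (Fin 2) ℂ) (i : Fin n) :
    siteOp n (c • A) i = c • siteOp n A i := by
  ext x y
  simp [siteOp, mul_assoc]

/-- The cyclic commutation relations of the halved Pauli matrices. -/
theorem half_pauli_commutator (w : Fin 3) :
    ((1 / 2 : ℂ) • pauli w) * ((1 / 2 : ℂ) • pauli (w + 1)) -
      ((1 / 2 : ℂ) • pauli (w + 1)) * ((1 / 2 : ℂ) • pauli w) =
      Complex.I • ((1 / 2 : ℂ) • pauli (w + 2)) := by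
  fin_cases w <;> ext k l <;> fin_cases k <;> fin_cases l <;>
    simp [pauli] <;> ring_nf <;> simp <;> ring

theorem spinOp_commutator (n : ℕ) (w : Fin 3) (i : Fin n) :
    spinOp n w i * spinOp n (w + 1) i - spinOp n (w + 1) i * spinOp n w i =
      Complex.I • spinOp n (w + 2) i := by
  simp only [spinOp]
  rw [siteOp_mul_siteOp, siteOp_mul_siteOp, ← siteOp_sub, half_pauli_commutator, siteOp_smul]

theorem sum_spinOp_commutator (n : ℕ) (a : Finset (Fin n)) (w : Fin 3) :
    (∑ i ∈ a, spinOp n w i) * (∑ i ∈ a, spinOp n (w + 1) i) -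
      (∑ i ∈ a, spinOp n (w + 1) i) * (∑ i ∈ a, spinOp n w i) =
      Complex.I • ∑ i ∈ a, spinOp n (w + 2) i := by
  rw [Finset.sum_mul_sum, Finset.sum_mul_sum, Finset.sum_comm (s := a) (t := a)
    (f := fun i j => spinOp n (w + 1) i * spinOp n w j), ← Finset.sum_sub_distrib,
    Finset.smul_sum]
  refine Finset.sum_congr rfl fun i hi => ?_
  rw [← Finset.sum_sub_distrib, Finset.sum_eq_single_of_mem i hi, spinOp_commutator]
  intro j _ hji
  exact sub_eq_zero.2 (siteOp_commute n _ _ hji.symm)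

/-- The Casimir element of `𝔰𝔲(2)` is central. -/
theorem commute_casimir {R A : Type*} [CommRing R] [Ring A] [Algebra R A] (c : R) (X Y Z : A)
    (hYZ : Y * Z - Z * Y = c • X) (hZX : Z * X - X * Z = c • Y) :
    Commute (X ^ 2 + Y ^ 2 + Z ^ 2) Z := by
  have expand : (X ^ 2 + Y ^ 2 + Z ^ 2) * Z - Z * (X ^ 2 + Y ^ 2 + Z ^ 2) =
      Y * (Y * Z - Z * Y) + (Y * Z - Z * Y) * Y -
        (X * (Z * X - X * Z) + (Z * X - X * Z) * X) := by
    noncomm_ring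
  refine sub_eq_zero.1 (expand.trans ?_)
  rw [hYZ, hZX]
  simp only [mul_smul_comm, smul_mul_assoc]
  abel

theorem totalSpin_commute_sum_spinOp (n : ℕ) (a : Finset (Fin n)) (w : Fin 3) :
    Commute (totalSpin n a) (∑ i ∈ a, spinOp n w i) := by
  have hsum : totalSpin n a = (∑ i ∈ a, spinOp n (w + 1) i) ^ 2 +
      (∑ i ∈ a, spinOp n (w + 2) i) ^ 2 + (∑ i ∈ a, spinOp n w i) ^ 2 := by
    rw [totalSpin, Fin.sum_univ_three]
    fin_cases w <;> simp <;> abel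
  have h₁ := sum_spinOp_commutator n a w
  have h₂ := sum_spinOp_commutator n a (w + 2)
  rw [show w + 2 + 1 = w by fin_cases w <;> rfl,
    show w + 2 + 2 = w + 1 by fin_cases w <;> rfl] at h₂
  rw [hsum]
  exact commute_casimir Complex.I _ _ _ h₂ h₁

theorem totalSpin_commute_spinOp (n : ℕ) {a : Finset (Fin n)} {i : Fin n} (hi : i ∉ a)
    (w : Fin 3) : Commute (totalSpin n a) (spinOp n w i) :=
  Commute.sum_left _ _ _ fun _ _ => Commute.pow_left
    (Commute.sum_left _ _ _ fun _ hj => siteOp_commute n _ _ (ne_of_mem_of_not_mem hj hi)) 2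

theorem totalSpin_commute_of_disjoint (n : ℕ) {a b : Finset (Fin n)} (h : Disjoint a b) :
    Commute (totalSpin n a) (totalSpin n b) :=
  Commute.sum_right _ _ _ fun w _ => Commute.pow_right
    (Commute.sum_right _ _ _ fun _ hi =>
      totalSpin_commute_spinOp n (Finset.disjoint_right.1 h hi) w) 2

theorem totalSpin_commute_of_subset (n : ℕ) {a b : Finset (Fin n)} (h : a ⊆ b) :
    Commute (totalSpin n a) (totalSpin n b) := by
  refine Commute.sum_right _ _ _ fun w _ => Commute.pow_right ?_ 2
  rw [← Finset.sum_sdiff h]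
  exact (Commute.sum_right _ _ _ fun i hi =>
    totalSpin_commute_spinOp n (Finset.mem_sdiff.1 hi).2 w).add_right
      (totalSpin_commute_sum_spinOp n a w)

/-- If `a` and `b` are disjoint, or one is contained in the other, then the total spin
operators `S²_a` and `S²_b` commute. -/
theorem totalSpin_comm (n : ℕ) (hn : 1 ≤ n) (a b : Finset (Fin n))
    (h : Disjoint a b ∨ a ⊆ b ∨ b ⊆ a) :
    totalSpin n a * totalSpin n b = totalSpin n b * totalSpin n a := by
  rcases h with h | h | h
  · exact totalSpin_commute_of_disjoint n h
  · exact totalSpin_commute_of_subset n h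
  · exact (totalSpin_commute_of_subset n h).symm
end

section
/- Let π be a permutation of Fin n and let a ⊆ Fin n be a subset that π maps onto itself (π '' a = a). Then U_π commutes with the total spin operator S²_a. In particular, for every permutation π, U_π commutes with the total spin operator S²_{Fin n} of all n spins. -/
open Matrix

/-- The permutation operator `U_π` on the `n`-qubit space, `(U_π ψ)(x) = ψ(x ∘ π)`. -/
def permOp (n : ℕ) (π : Equiv.Perm (Fin n)) :
    Matrix (Fin n → Fin 2) (Fin n → Fin 2) ℂ :=
  Matrix.of fun x y => if y = x ∘ π then (1 : ℂ) else 0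

theorem permOp_mul_apply (n : ℕ) (π : Equiv.Perm (Fin n))
    (M : Matrix (Fin n → Fin 2) (Fin n → Fin 2) ℂ) (x y : Fin n → Fin 2) :
    (permOp n π * M) x y = M (x ∘ π) y := by
  simp [Matrix.mul_apply, permOp]

theorem mul_permOp_apply (n : ℕ) (π : Equiv.Perm (Fin n))
    (M : Matrix (Fin n → Fin 2) (Fin n → Fin 2) ℂ) (x y : Fin n → Fin 2) :
    (M * permOp n π) x y = M x (y ∘ π.symm) := by
  have h : ∀ z : Fin n → Fin 2, y = z ∘ π ↔ y ∘ π.symm = z := fun z =>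
    (Equiv.comp_symm_eq π z y).symm
  simp [Matrix.mul_apply, permOp, h]

/-- Conjugating by `U_π` moves a one-site operator from site `i` to site `π i`. -/
theorem permOp_mul_siteOp (n : ℕ) (π : Equiv.Perm (Fin n)) (A : Matrix (Fin 2) (Fin 2) ℂ)
    (i : Fin n) : permOp n π * siteOp n A i = siteOp n A (π i) * permOp n π := by
  ext x y
  rw [permOp_mul_apply, mul_permOp_apply]
  simp only [siteOp, Matrix.of_apply, Function.comp_apply, Equiv.symm_apply_apply]
  congr 1
  exact Finset.prod_equiv π (by simp) (by simp)

theorem commute_permOp_totalSpin (n : ℕ) (π : Equiv.Perm (Fin n)) (a : Finset (Fin n))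
    (ha : a.image π = a) : Commute (permOp n π) (totalSpin n a) := by
  refine Commute.sum_right _ _ _ fun w _ => Commute.pow_right ?_ 2
  calc permOp n π * ∑ i ∈ a, spinOp n w i
      = (∑ i ∈ a, spinOp n w (π i)) * permOp n π := by
        simp only [Finset.mul_sum, Finset.sum_mul, spinOp, permOp_mul_siteOp]
    _ = (∑ i ∈ a, spinOp n w i) * permOp n π := by
        rw [← Finset.sum_image (f := spinOp n w) π.injective.injOn, ha]

/-- If the permutation `π` maps the subset `a` onto itself, then `U_π` commutes with the
total spin operator `S²_a`; in particular every `U_π` commutes with `S²_{Fin n}`. -/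
theorem permOp_comm_totalSpin (n : ℕ) (hn : 1 ≤ n) :
    (∀ (π : Equiv.Perm (Fin n)) (a : Finset (Fin n)), a.image π = a →
      permOp n π * totalSpin n a = totalSpin n a * permOp n π) ∧
    (∀ π : Equiv.Perm (Fin n),
      permOp n π * totalSpin n Finset.univ = totalSpin n Finset.univ * permOp n π) := by
  exact ⟨fun π a ha => commute_permOp_totalSpin n π a ha, fun π =>
    commute_permOp_totalSpin n π _ (Finset.image_univ_equiv π)⟩
end

section
/- On the Hilbert space of two spin-1/2 particles (n = 2), the swap operator U_σ (where σ is the transposition exchanging the two spins) satisfies the exchange identity U_σ = S²_{Fin 2} − 1. Consequently, on the eigenspace of S²_{Fin 2} with eigenvalue j(j+1) for j ∈ {0, 1}, exchanging the two spins multiplies the state by the phase (−1)^{1−j}. -/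
open Matrix

theorem sum_fin_two_arrow {α M : Type*} [Fintype α] [AddCommMonoid M] (f : (Fin 2 → α) → M) :
    ∑ z, f z = ∑ a, ∑ b, f ![a, b] := by
  rw [← Fintype.sum_prod_type', ← (finTwoArrowEquiv α).symm.sum_comp]
  rfl

theorem spinOp_two_zero_apply (w : Fin 3) (a b c d : Fin 2) :
    spinOp 2 w 0 ![a, b] ![c, d] = 1 / 2 * pauli w a c * if b = d then 1 else 0 := by
  have h : (Finset.univ.filter (· ≠ (0 : Fin 2))) = {1} := by decide
  simp [spinOp, siteOp, h]

theorem spinOp_two_one_apply (w : Fin 3) (a b c d : Fin 2) :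
    spinOp 2 w 1 ![a, b] ![c, d] = 1 / 2 * pauli w b d * if a = c then 1 else 0 := by
  have h : (Finset.univ.filter (· ≠ (1 : Fin 2))) = {0} := by decide
  simp [spinOp, siteOp, h]

theorem permOp_two_swap_apply (a b c d : Fin 2) :
    permOp 2 (Equiv.swap 0 1) ![a, b] ![c, d] = if c = b ∧ d = a then 1 else 0 := by
  simp [permOp, funext_iff]

theorem permOp_two_swap_eq :
    permOp 2 (Equiv.swap 0 1) = totalSpin 2 Finset.univ - 1 := by
  ext x y
  obtain ⟨⟨a, b⟩, rfl⟩ := (finTwoArrowEquiv (Fin 2)).symm.surjective x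
  obtain ⟨⟨c, d⟩, rfl⟩ := (finTwoArrowEquiv (Fin 2)).symm.surjective y
  change permOp 2 _ ![a, b] ![c, d] = (totalSpin 2 Finset.univ - 1) ![a, b] ![c, d]
  rw [permOp_two_swap_apply]
  simp only [totalSpin, Matrix.sub_apply, pow_two, Matrix.mul_apply,
    sum_fin_two_arrow, Fin.sum_univ_two, Fin.sum_univ_three, Matrix.add_apply,
    spinOp_two_zero_apply, spinOp_two_one_apply, Matrix.one_apply]
  fin_cases a <;> fin_cases b <;> fin_cases c <;> fin_cases d <;>
    simp [pauli] <;> ring_nf <;> simp <;> norm_num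

/-- Exchange identity for two spin-1/2 particles: the swap operator equals
`S²_{Fin 2} − 1`, and consequently on the eigenspace of `S²_{Fin 2}` with eigenvalue
`j(j+1)` (`j ∈ {0,1}`) the swap acts as the phase `(−1)^{1−j}`. -/
theorem swap_eq_totalSpin_sub_one :
    permOp 2 (Equiv.swap 0 1) = totalSpin 2 Finset.univ - 1 ∧
    ∀ j : ℕ, (j = 0 ∨ j = 1) → ∀ ψ : (Fin 2 → Fin 2) → ℂ,
      totalSpin 2 Finset.univ *ᵥ ψ = ((j * (j + 1) : ℕ) : ℂ) • ψ →
      permOp 2 (Equiv.swap 0 1) *ᵥ ψ = ((-1 : ℂ) ^ (1 - j)) • ψ := by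
  refine ⟨permOp_two_swap_eq, fun j hj ψ hψ => ?_⟩
  rw [permOp_two_swap_eq, Matrix.sub_mulVec, hψ, Matrix.one_mulVec]
  obtain rfl | rfl := hj
  · simp
  · ext x
    simp
    ring
end

section
/- For three spin-1/2 particles, the three mutually commuting Hermitian operators S²_{Fin 3}, S²_{{0,1}}, and Z form a complete set of commuting observables: every simultaneous eigenspace is at most one-dimensional. That is, if v and w are simultaneous eigenvectors of S²_{Fin 3}, S²_{{0,1}} and Z with the same triple of eigenvalues, then v and w are linearly dependent. -/
open Matrix

/-- The total azimuthal angular momentum operator `Z = Σ_i S_z^{(i)}`. -/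
noncomputable def totalZ (n : ℕ) : Matrix (Fin n → Fin 2) (Fin n → Fin 2) ℂ :=
  ∑ i : Fin n, spinOp n 2 i

theorem siteOp_isHermitian (n : ℕ) {A : Matrix (Fin 2) (Fin 2) ℂ} (hA : A.IsHermitian)
    (i : Fin n) : (siteOp n A i).IsHermitian := by
  ext x y
  simp only [siteOp, conjTranspose_apply, of_apply, star_mul', hA.apply, star_prod,
    apply_ite star, star_one, star_zero, eq_comm]

theorem spinOp_isHermitian (n : ℕ) (w : Fin 3) (i : Fin n) : (spinOp n w i).IsHermitian := by
  refine siteOp_isHermitian n ?_ i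
  ext a b
  fin_cases w <;> fin_cases a <;> fin_cases b <;> simp [pauli]

theorem sum_spinOp_isHermitian (n : ℕ) (w : Fin 3) (a : Finset (Fin n)) :
    (∑ i ∈ a, spinOp n w i).IsHermitian :=
  isSelfAdjoint_sum a fun i _ => spinOp_isHermitian n w i

theorem totalSpin_isHermitian (n : ℕ) (a : Finset (Fin n)) : (totalSpin n a).IsHermitian :=
  isSelfAdjoint_sum _ fun w _ => (sum_spinOp_isHermitian n w a).pow 2

theorem comp_swap_eq_update {ι α : Type*} [DecidableEq ι] (x : ι → α) (i j : ι) :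
    x ∘ Equiv.swap i j = Function.update (Function.update x j (x i)) i (x j) := by
  ext k
  simp only [Function.comp_apply, Equiv.swap_apply_def, Function.update_apply]
  split_ifs <;> rfl

theorem sum_spinOp_mul_spinOp_mulVec (n : ℕ) (i j : Fin n) (v : (Fin n → Fin 2) → ℂ)
    (x : Fin n → Fin 2) :
    ((∑ w, spinOp n w i * spinOp n w j) *ᵥ v) x =
      if i = j then 3 / 4 * v x else 1 / 2 * v (x ∘ Equiv.swap i j) - 1 / 4 * v x := by
  simp only [Fin.sum_univ_three, add_mulVec, ← mulVec_mulVec, Pi.add_apply, spinOp,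
    siteOp_mulVec, Fin.sum_univ_two]
  split_ifs with h
  · subst h
    obtain h | h : x i = 0 ∨ x i = 1 := by omega
    all_goals
      have e := Function.update_eq_self i x
      rw [h] at e
      simp [h, pauli, e]
      ring_nf
      try simp only [Complex.I_sq]
      try ring
  · rw [comp_swap_eq_update]
    have h' : j ≠ i := Ne.symm h
    have hi := Function.update_eq_self i x
    have hj := Function.update_eq_self j x
    obtain hx | hx : x i = 0 ∨ x i = 1 := by omega
    all_goals
      obtain hy | hy : x j = 0 ∨ x j = 1 := by omega
      all_goals
        rw [hx] at hi
        rw [hy] at hj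
        simp [hx, hy, pauli, h', hi, hj, Function.update_comm h']
        ring_nf
        try simp only [Complex.I_sq]
        try ring

theorem totalSpin_mulVec (n : ℕ) (a : Finset (Fin n)) (v : (Fin n → Fin 2) → ℂ)
    (x : Fin n → Fin 2) :
    (totalSpin n a *ᵥ v) x = ∑ i ∈ a, ∑ j ∈ a,
      if i = j then 3 / 4 * v x else 1 / 2 * v (x ∘ Equiv.swap i j) - 1 / 4 * v x := by
  have h : totalSpin n a = ∑ i ∈ a, ∑ j ∈ a, ∑ w, spinOp n w i * spinOp n w j := by
    simp only [totalSpin, sq, Finset.sum_mul_sum]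
    rw [Finset.sum_comm]
    exact Finset.sum_congr rfl fun i _ => Finset.sum_comm
  simp only [h, sum_mulVec, Finset.sum_apply, ← sum_spinOp_mul_spinOp_mulVec]

theorem totalSpin_three_univ_mulVec (v : (Fin 3 → Fin 2) → ℂ) (x : Fin 3 → Fin 2) :
    (totalSpin 3 Finset.univ *ᵥ v) x = 3 / 4 * v x + v (x ∘ Equiv.swap 0 1) +
      v (x ∘ Equiv.swap 0 2) + v (x ∘ Equiv.swap 1 2) := by
  simp [totalSpin_mulVec, Fin.sum_univ_three, Equiv.swap_comm (1 : Fin 3) 0,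
    Equiv.swap_comm (2 : Fin 3) 0, Equiv.swap_comm (2 : Fin 3) 1]
  ring

theorem totalSpin_three_pair_mulVec (v : (Fin 3 → Fin 2) → ℂ) (x : Fin 3 → Fin 2) :
    (totalSpin 3 {0, 1} *ᵥ v) x = v x + v (x ∘ Equiv.swap 0 1) := by
  simp [totalSpin_mulVec, Equiv.swap_comm (1 : Fin 3) 0]
  ring

theorem totalZ_mulVec (n : ℕ) (v : (Fin n → Fin 2) → ℂ) (x : Fin n → Fin 2) :
    (totalZ n *ᵥ v) x = (∑ i, if x i = 0 then (1 / 2 : ℂ) else -(1 / 2)) * v x := by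
  simp only [totalZ, sum_mulVec, Finset.sum_apply, Finset.sum_mul, spinOp, siteOp_mulVec,
    Fin.sum_univ_two]
  refine Finset.sum_congr rfl fun i _ => ?_
  have e := Function.update_eq_self i x
  obtain h | h : x i = 0 ∨ x i = 1 := by omega
  all_goals
    rw [h] at e
    simp [h, pauli, e]

theorem commute_of_mulVec {ι : Type*} [Fintype ι] {A B : Matrix ι ι ℂ}
    (h : ∀ v x, (A *ᵥ (B *ᵥ v)) x = (B *ᵥ (A *ᵥ v)) x) : Commute A B := by
  classical
  refine mulVec_injective (funext fun v => ?_)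
  rw [← mulVec_mulVec, ← mulVec_mulVec]
  exact funext (h v)

theorem totalSpin_commute_totalZ (n : ℕ) (a : Finset (Fin n)) :
    Commute (totalSpin n a) (totalZ n) := by
  refine commute_of_mulVec fun v x => ?_
  have hz (σ : Equiv.Perm (Fin n)) :
      (∑ i, if (x ∘ σ) i = 0 then (1 / 2 : ℂ) else -(1 / 2)) =
        ∑ i, if x i = 0 then (1 / 2 : ℂ) else -(1 / 2) :=
    Equiv.sum_comp σ fun i => if x i = 0 then (1 / 2 : ℂ) else -(1 / 2)
  simp only [totalSpin_mulVec, totalZ_mulVec, hz, Finset.mul_sum]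
  refine Finset.sum_congr rfl fun i _ => Finset.sum_congr rfl fun j _ => ?_
  split_ifs <;> ring

theorem totalSpin_three_commute :
    Commute (totalSpin 3 Finset.univ) (totalSpin 3 ({0, 1} : Finset (Fin 3))) := by
  refine commute_of_mulVec fun v x => ?_
  have h₁ : (Equiv.swap 0 2 * Equiv.swap 0 1 : Equiv.Perm (Fin 3)) =
      Equiv.swap 0 1 * Equiv.swap 1 2 := by decide
  have h₂ : (Equiv.swap 1 2 * Equiv.swap 0 1 : Equiv.Perm (Fin 3)) =
      Equiv.swap 0 1 * Equiv.swap 0 2 := by decide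
  simp only [totalSpin_three_univ_mulVec, totalSpin_three_pair_mulVec, Function.comp_assoc,
    ← Equiv.Perm.coe_mul, h₁, h₂]
  ring

/-- The simultaneous eigenvalue equations of the two total spins on a sector with one spin
differing from the other two; `a` is the amplitude where that spin is the last one. -/
theorem sector_dependent {lam mu a b c a' b' c' : ℂ}
    (ha : a + a = mu * a) (hb : b + c = mu * b) (hc : c + b = mu * c)
    (hl : 3 / 4 * a + a + c + b = lam * a)
    (ha' : a' + a' = mu * a') (hb' : b' + c' = mu * b') (hc' : c' + b' = mu * c')
    (hl' : 3 / 4 * a' + a' + c' + b' = lam * a') :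
    a * b' = b * a' ∧ a * c' = c * a' ∧ b * c' = c * b' := by
  by_cases hmu : mu = 2
  · subst hmu
    obtain rfl : c = b := by linear_combination hb
    obtain rfl : c' = b' := by linear_combination hb'
    have h : a * c' = c * a' := by linear_combination (a * hl' - a' * hl) / 2
    exact ⟨h, h, rfl⟩
  · have key {z : ℂ} (h : (mu - 2) * z = 0) : z = 0 :=
      (mul_eq_zero.mp h).resolve_left (sub_ne_zero.mpr hmu)
    have h0 : a = 0 := key (by linear_combination -ha)
    have h0' : a' = 0 := key (by linear_combination -ha')
    have h1 : b + c = 0 := key (by linear_combination -hb - hc)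
    have h1' : b' + c' = 0 := key (by linear_combination -hb' - hc')
    refine ⟨?_, ?_, ?_⟩
    · rw [h0, h0']; ring
    · rw [h0, h0']; ring
    · linear_combination b * h1' - b' * h1

/-- For three spin-1/2 particles, the mutually commuting Hermitian operators
`S²_{Fin 3}`, `S²_{{0,1}}` and `Z` form a complete set of commuting observables:
any two simultaneous eigenvectors with the same triple of eigenvalues are linearly
dependent. -/
theorem csco_three_spins :
    (totalSpin 3 Finset.univ).IsHermitian ∧
    (totalSpin 3 ({0, 1} : Finset (Fin 3))).IsHermitian ∧
    (totalZ 3).IsHermitian ∧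
    Commute (totalSpin 3 Finset.univ) (totalSpin 3 ({0, 1} : Finset (Fin 3))) ∧
    Commute (totalSpin 3 Finset.univ) (totalZ 3) ∧
    Commute (totalSpin 3 ({0, 1} : Finset (Fin 3))) (totalZ 3) ∧
    ∀ (lam mu m : ℂ) (v w : (Fin 3 → Fin 2) → ℂ), v ≠ 0 → w ≠ 0 →
      totalSpin 3 Finset.univ *ᵥ v = lam • v →
      totalSpin 3 ({0, 1} : Finset (Fin 3)) *ᵥ v = mu • v →
      totalZ 3 *ᵥ v = m • v →
      totalSpin 3 Finset.univ *ᵥ w = lam • w →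
      totalSpin 3 ({0, 1} : Finset (Fin 3)) *ᵥ w = mu • w →
      totalZ 3 *ᵥ w = m • w →
      ∃ c : ℂ, w = c • v := by
  refine ⟨totalSpin_isHermitian _ _, totalSpin_isHermitian _ _, sum_spinOp_isHermitian _ _ _,
    totalSpin_three_commute, totalSpin_commute_totalZ _ _, totalSpin_commute_totalZ _ _, ?_⟩
  intro lam mu m v w hv _ hSv hTv hZv hSw hTw hZw
  have cross (x y : Fin 3 → Fin 2) : v x * w y = v y * w x := by
    have hZ (x y : Fin 3 → Fin 2) :
        ((∑ i, if x i = 0 then (1 / 2 : ℂ) else -(1 / 2)) -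
          ∑ i, if y i = 0 then (1 / 2 : ℂ) else -(1 / 2)) * (v x * w y) = 0 := by
      have h₁ := congrFun hZv x
      have h₂ := congrFun hZw y
      rw [totalZ_mulVec, Pi.smul_apply, smul_eq_mul] at h₁ h₂
      linear_combination w y * h₁ - v x * h₂
    have comp_swaps (p q r : Fin 2) : ![p, q, r] ∘ Equiv.swap 0 1 = ![q, p, r] ∧
        ![p, q, r] ∘ Equiv.swap 0 2 = ![r, q, p] ∧ ![p, q, r] ∘ Equiv.swap 1 2 = ![p, r, q] := by
      revert p q r; decide
    have hS {u : (Fin 3 → Fin 2) → ℂ} (h : totalSpin 3 Finset.univ *ᵥ u = lam • u)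
        (p q r : Fin 2) : 3 / 4 * u ![p, q, r] + u ![q, p, r] + u ![r, q, p] + u ![p, r, q] =
          lam * u ![p, q, r] := by
      have := congrFun h ![p, q, r]
      rwa [totalSpin_three_univ_mulVec, (comp_swaps p q r).1, (comp_swaps p q r).2.1,
        (comp_swaps p q r).2.2] at this
    have hT {u : (Fin 3 → Fin 2) → ℂ} (h : totalSpin 3 {0, 1} *ᵥ u = mu • u) (p q r : Fin 2) :
        u ![p, q, r] + u ![q, p, r] = mu * u ![p, q, r] := by
      have := congrFun h ![p, q, r]
      rwa [totalSpin_three_pair_mulVec, (comp_swaps p q r).1] at this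
    have sector (s t : Fin 2) := sector_dependent
      (hT hTv s s t) (hT hTv s t s) (hT hTv t s s) (hS hSv s s t)
      (hT hTw s s t) (hT hTw s t s) (hT hTw t s s) (hS hSw s s t)
    have h₀ := sector 0 1
    have h₁ := sector 1 0
    simp only [Fin.sum_univ_three] at hZ
    have hxy := hZ x y
    have hyx := hZ y x
    have hvec (x : Fin 3 → Fin 2) : x = ![x 0, x 1, x 2] := by
      ext i; fin_cases i <;> rfl
    have hvx := congrArg v (hvec x)
    have hwx := congrArg w (hvec x)
    have hvy := congrArg v (hvec y)
    have hwy := congrArg w (hvec y)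
    rw [hvx, hwy] at hxy ⊢
    rw [hvy, hwx] at hyx ⊢
    clear hvx hwx hvy hwy
    generalize x 0 = x₀, x 1 = x₁, x 2 = x₂, y 0 = y₀, y 1 = y₁, y 2 = y₂ at hxy hyx ⊢
    clear hZ comp_swaps hS hT sector hvec hv hSv hTv hZv hSw hTw hZw
    obtain ⟨h₂, h₃, h₄⟩ := h₀
    obtain ⟨h₅, h₆, h₇⟩ := h₁
    obtain rfl | rfl : x₀ = 0 ∨ x₀ = 1 := by omega
    all_goals obtain rfl | rfl : x₁ = 0 ∨ x₁ = 1 := by omega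
    all_goals obtain rfl | rfl : x₂ = 0 ∨ x₂ = 1 := by omega
    all_goals obtain rfl | rfl : y₀ = 0 ∨ y₀ = 1 := by omega
    all_goals obtain rfl | rfl : y₁ = 0 ∨ y₁ = 1 := by omega
    all_goals obtain rfl | rfl : y₂ = 0 ∨ y₂ = 1 := by omega
    all_goals
      first
      | with_reducible rfl
      | with_reducible assumption
      | (symm; with_reducible assumption)
      | (norm_num at hxy hyx
         grind)
  obtain ⟨x, hx⟩ := Function.ne_iff.mp hv
  refine ⟨w x / v x, funext fun y => ?_⟩
  rw [Pi.smul_apply, smul_eq_mul, div_mul_eq_mul_div, eq_div_iff hx]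
  linear_combination cross x y
end

section
/- Let u be any 2 × 2 unitary complex matrix and let u^{⊗n} denote its n-fold Kronecker (tensor) power, the matrix with entries Π_{i : Fin n} u(x i, y i). Then for every subset a ⊆ Fin n, u^{⊗n} commutes with the total spin operator S²_a. (Hence permutational computations are impervious to uniform magnetic fields: the span of the coupling-tree states is a noiseless subsystem for errors of the form u^{⊗n}.) -/
open Matrix

/-- The `n`-fold Kronecker (tensor) power of a 2×2 matrix, with entries
`(u^{⊗n})(x,y) = Π_i u (x i) (y i)`. -/
noncomputable def tensorPow (n : ℕ) (u : Matrix (Fin 2) (Fin 2) ℂ) :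
    Matrix (Fin n → Fin 2) (Fin n → Fin 2) ℂ :=
  Matrix.of fun x y => ∏ i : Fin n, u (x i) (y i)

section Casimir

variable {m R B : Type*} [Fintype m] [DecidableEq m] [CommRing R] [AddCommGroup B] [Module R B]

/-- A matrix slides from the left of the first slot of the Casimir tensor
`∑ E_ij ⊗ E_ji` to the right of the second slot. -/
lemma sum_single_mul_left (b : Matrix m m R →ₗ[R] Matrix m m R →ₗ[R] B) (u : Matrix m m R) :
    ∑ i, ∑ j, b (u * single i j 1) (single j i 1) =
      ∑ i, ∑ j, b (single i j 1) (single j i 1 * u) := by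
  have hl (i j : m) : u * single i j 1 = ∑ k, u k i • single k j (1 : R) := by
    ext p q
    simp [Matrix.mul_apply, Matrix.sum_apply, Matrix.single_apply, ite_and]
  have hr (i j : m) : single j i 1 * u = ∑ k, u i k • single j k (1 : R) := by
    ext p q
    simp [Matrix.mul_apply, Matrix.sum_apply, Matrix.single_apply, ite_and]
  simp only [hl, hr, map_sum, map_smul, LinearMap.sum_apply, LinearMap.smul_apply]
  calc _ = ∑ i, ∑ k, ∑ j, u k i • b (single k j 1) (single j i 1) :=
        Finset.sum_congr rfl fun _ _ => Finset.sum_comm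
    _ = ∑ k, ∑ i, ∑ j, u k i • b (single k j 1) (single j i 1) := Finset.sum_comm
    _ = _ := Finset.sum_congr rfl fun _ _ => Finset.sum_comm

/-- The Casimir tensor `∑ E_ij ⊗ E_ji` is invariant under conjugation. -/
lemma sum_single_conj (b : Matrix m m R →ₗ[R] Matrix m m R →ₗ[R] B) {u v : Matrix m m R}
    (huv : u * v = 1) :
    ∑ i, ∑ j, b (u * single i j 1 * v) (u * single j i 1 * v) =
      ∑ i, ∑ j, b (single i j 1) (single j i 1) := by
  have hv := sum_single_mul_left
    (b.compl₁₂ (LinearMap.mulLeft R u) (LinearMap.mulLeft R u ∘ₗ LinearMap.mulRight R v)).flip v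
  have hu := sum_single_mul_left (b.compl₂ (LinearMap.mulRight R v)) u
  simp only [LinearMap.flip_apply, LinearMap.compl₁₂_apply, LinearMap.compl₂_apply,
    LinearMap.comp_apply, LinearMap.mulLeft_apply, LinearMap.mulRight_apply,
    mul_assoc, huv, mul_one] at hu hv
  rw [← hu, Finset.sum_comm]
  simp only [mul_assoc]
  rw [← hv, Finset.sum_comm]
  simp only [← mul_assoc, huv, one_mul]

end Casimir

/-- The Pauli form of the Casimir tensor of `gl₂`. -/
lemma sum_pauli {B : Type*} [AddCommGroup B] [Module ℂ B]
    (b : Matrix (Fin 2) (Fin 2) ℂ →ₗ[ℂ] Matrix (Fin 2) (Fin 2) ℂ →ₗ[ℂ] B) :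
    ∑ w, b (pauli w) (pauli w) =
      (2 : ℂ) • ∑ i, ∑ j, b (single i j 1) (single j i 1) - b 1 1 := by
  have hx : pauli 0 = single 0 1 1 + single 1 0 1 := by
    ext i j; fin_cases i <;> fin_cases j <;> simp [pauli]
  have hy : pauli 1 = Complex.I • (single 1 0 1 - single 0 1 1) := by
    ext i j; fin_cases i <;> fin_cases j <;> simp [pauli]
  have hz : pauli 2 = single 0 0 1 - single 1 1 1 := by
    ext i j; fin_cases i <;> fin_cases j <;> simp [pauli]
  have h1 : (1 : Matrix (Fin 2) (Fin 2) ℂ) = single 0 0 1 + single 1 1 1 := by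
    ext i j; fin_cases i <;> fin_cases j <;> simp
  simp only [Fin.sum_univ_three, Fin.sum_univ_two, hx, hy, hz, h1, map_add, map_sub, map_smul,
    LinearMap.add_apply, LinearMap.sub_apply, LinearMap.smul_apply, smul_sub, smul_smul, Complex.I_mul_I]
  module

lemma sum_pauli_conj {B : Type*} [AddCommGroup B] [Module ℂ B]
    (b : Matrix (Fin 2) (Fin 2) ℂ →ₗ[ℂ] Matrix (Fin 2) (Fin 2) ℂ →ₗ[ℂ] B)
    {u v : Matrix (Fin 2) (Fin 2) ℂ} (huv : u * v = 1) :
    ∑ w, b (u * pauli w * v) (u * pauli w * v) = ∑ w, b (pauli w) (pauli w) := by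
  let c := LinearMap.mulRight ℂ v ∘ₗ LinearMap.mulLeft ℂ u
  have h := sum_pauli (b.compl₁₂ c c)
  simp only [c, LinearMap.compl₁₂_apply, LinearMap.comp_apply, LinearMap.mulLeft_apply,
    LinearMap.mulRight_apply, mul_one, huv, sum_single_conj b huv] at h
  rw [h, sum_pauli]

/-- The tensor product of a family of 2×2 matrices. -/
def piKronecker {n : ℕ} (M : Fin n → Matrix (Fin 2) (Fin 2) ℂ) :
    Matrix (Fin n → Fin 2) (Fin n → Fin 2) ℂ :=
  Matrix.of fun x y => ∏ i, M i (x i) (y i)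

lemma piKronecker_mul {n : ℕ} (M N : Fin n → Matrix (Fin 2) (Fin 2) ℂ) :
    piKronecker M * piKronecker N = piKronecker (M * N) := by
  ext x y
  simp only [piKronecker, Matrix.mul_apply, Matrix.of_apply, Pi.mul_apply, Fintype.prod_sum,
    Finset.prod_mul_distrib]

lemma siteOp_eq_piKronecker {n : ℕ} (A : Matrix (Fin 2) (Fin 2) ℂ) (i : Fin n) :
    siteOp n A i = piKronecker (Function.update 1 i A) := by
  ext x y
  simp only [siteOp, piKronecker, Matrix.of_apply]
  rw [← Finset.mul_prod_erase Finset.univ _ (Finset.mem_univ i), Function.update_self,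
    Finset.filter_ne']
  congr 1
  refine Finset.prod_congr rfl fun j hj => ?_
  rw [Function.update_of_ne (Finset.ne_of_mem_erase hj), Pi.one_apply, Matrix.one_apply]

lemma tensorPow_mul_siteOp {n : ℕ} {u v : Matrix (Fin 2) (Fin 2) ℂ} (hvu : v * u = 1)
    (A : Matrix (Fin 2) (Fin 2) ℂ) (i : Fin n) :
    tensorPow n u * siteOp n A i = siteOp n (u * A * v) i * tensorPow n u := by
  rw [siteOp_eq_piKronecker, siteOp_eq_piKronecker,
    show tensorPow n u = piKronecker fun _ => u from rfl, piKronecker_mul, piKronecker_mul]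
  congr 1
  funext j
  by_cases h : j = i
  · subst h
    simp [mul_assoc, hvu]
  · simp [h]

/-- The sum over the sites in `a` of a one-site operator, as a linear map. -/
noncomputable def sumSiteOp (n : ℕ) (a : Finset (Fin n)) :
    Matrix (Fin 2) (Fin 2) ℂ →ₗ[ℂ] Matrix (Fin n → Fin 2) (Fin n → Fin 2) ℂ where
  toFun A := ∑ i ∈ a, siteOp n A i
  map_add' A B := by
    rw [← Finset.sum_add_distrib]
    refine Finset.sum_congr rfl fun i _ => ?_
    ext x y
    simp [siteOp, add_mul]
  map_smul' c A := by
    rw [RingHom.id_apply, Finset.smul_sum]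
    refine Finset.sum_congr rfl fun i _ => ?_
    ext x y
    simp [siteOp, mul_assoc]

lemma tensorPow_mul_sumSiteOp {n : ℕ} {u v : Matrix (Fin 2) (Fin 2) ℂ} (hvu : v * u = 1)
    (a : Finset (Fin n)) (A : Matrix (Fin 2) (Fin 2) ℂ) :
    tensorPow n u * sumSiteOp n a A = sumSiteOp n a (u * A * v) * tensorPow n u := by
  simp only [sumSiteOp, LinearMap.coe_mk, AddHom.coe_mk, Finset.mul_sum, Finset.sum_mul,
    tensorPow_mul_siteOp hvu]

lemma totalSpin_eq_sum_sumSiteOp (n : ℕ) (a : Finset (Fin n)) :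
    totalSpin n a =
      (1 / 4 : ℂ) • ∑ w, sumSiteOp n a (pauli w) * sumSiteOp n a (pauli w) := by
  rw [totalSpin, Finset.smul_sum]
  refine Finset.sum_congr rfl fun w _ => ?_
  change (sumSiteOp n a ((1 / 2 : ℂ) • pauli w)) ^ 2 = _
  rw [map_smul, sq, smul_mul_smul_comm]
  norm_num

/-- For any 2×2 unitary `u`, the tensor power `u^{⊗n}` commutes with every total spin
operator `S²_a`; hence permutational computations are impervious to uniform magnetic
fields. -/
theorem tensorPow_comm_totalSpin (n : ℕ) (hn : 1 ≤ n)
    (u : Matrix (Fin 2) (Fin 2) ℂ) (hu : uᴴ * u = 1) (a : Finset (Fin n)) :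
    tensorPow n u * totalSpin n a = totalSpin n a * tensorPow n u := by
  have huv : u * uᴴ = 1 := mul_eq_one_comm.mp hu
  have hC := sum_pauli_conj ((LinearMap.mul ℂ _).compl₁₂ (sumSiteOp n a) (sumSiteOp n a)) huv
  simp only [LinearMap.compl₁₂_apply, LinearMap.mul_apply'] at hC
  rw [totalSpin_eq_sum_sumSiteOp, mul_smul_comm, smul_mul_assoc]
  congr 1
  conv_rhs => rw [← hC]
  rw [Finset.mul_sum, Finset.sum_mul]
  refine Finset.sum_congr rfl fun w _ => ?_
  rw [← mul_assoc, tensorPow_mul_sumSiteOp hu, mul_assoc, tensorPow_mul_sumSiteOp hu]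
  simp only [mul_assoc]
end
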